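/- Let w be a word of length n ≥ 1 and let π = π_w. If 2·π^{(2)}[n] ≥ n − 2 (i.e., π[π[n]] ≥ n/2 − 1), then w[π[n]+1] = w[π^{(2)}[n]+1]. -/

import Mathlib

/- A word over alphabet `α` is modelled as `w : ℕ → α`, indexed `w 1, …, w n`. -/

/-- `IsBorder w i b`: `b` is the length of a border (possibly non-proper) of the
prefix `w[1..i]`, i.e. `b ≤ i` and `w[1..b] = w[i-b+1..i]`. -/
def IsBorder {α : Type*} (w : ℕ → α) (i b : ℕ) : Prop :=
  b ≤ i ∧ ∀ t, 1 ≤ t → t ≤ b → w t = w (i - b + t)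

/-- The failure function (border array) `π_w[i]`: the length of the longest proper
border of `w[1..i]`. -/
noncomputable def piF {α : Type*} (w : ℕ → α) (i : ℕ) : ℕ :=
  sSup {b | b < i ∧ IsBorder w i b}

/- The strong failure function `π'_w[i]` of a word of length `n`, valued in `ℤ`:
`π'_w[n] = π_w[n]`, and for `i < n` the length of the longest proper border `b` of
`w[1..i]` with `w[b+1] ≠ w[i+1]`, or `-1` if no such border exists. -/
open Classical in
noncomputable def piF' {α : Type*} (w : ℕ → α) (n i : ℕ) : ℤ :=
  if i = n then (piF w i : ℤ)
  else if ({b | b < i ∧ IsBorder w i b ∧ w (b + 1) ≠ w (i + 1)} : Set ℕ).Nonempty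
    then ((sSup {b | b < i ∧ IsBorder w i b ∧ w (b + 1) ≠ w (i + 1)} : ℕ) : ℤ)
    else -1

/-- `HasWordPeriod w m p`: the prefix `w[1..m]` has period `p`. -/
def HasWordPeriod {α : Type*} (w : ℕ → α) (m p : ℕ) : Prop :=
  ∀ t, 1 ≤ t → t + p ≤ m → w t = w (t + p)

theorem isBorder_iff_hasWordPeriod {α : Type*} (w : ℕ → α) {m b : ℕ} (hb : b ≤ m) :
    IsBorder w m b ↔ HasWordPeriod w m (m - b) := by
  constructor
  · rintro ⟨-, hw⟩ t ht htm
    rw [hw t ht (by omega), Nat.add_comm]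
  · refine fun hw => ⟨hb, fun t ht htb => ?_⟩
    rw [hw t ht (by omega), Nat.add_comm]

theorem piF_mem {α : Type*} (w : ℕ → α) {m : ℕ} (hm : 0 < m) :
    piF w m < m ∧ IsBorder w m (piF w m) :=
  Nat.sSup_mem (s := {b | b < m ∧ IsBorder w m b})
    ⟨0, hm, Nat.zero_le _, fun t ht ht' => by omega⟩ ⟨m, fun _ hb => hb.1.le⟩

theorem le_piF {α : Type*} (w : ℕ → α) {m b : ℕ} (hb : b < m) (hw : IsBorder w m b) :
    b ≤ piF w m :=
  le_csSup (s := {b | b < m ∧ IsBorder w m b}) ⟨m, fun _ hb => hb.1.le⟩ ⟨hb, hw⟩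

theorem piF_zero {α : Type*} (w : ℕ → α) : piF w 0 = 0 := by
  simp [piF]

theorem HasWordPeriod.sub {α : Type*} {w : ℕ → α} {m p q : ℕ} (hp : HasWordPeriod w m p)
    (hq : HasWordPeriod w m q) (hqp : q ≤ p) (hm : p + q ≤ m) : HasWordPeriod w m (p - q) := by
  intro t ht htm
  by_cases htq : q < t
  · have h₁ := hq (t - q) (by omega) (by omega)
    have h₂ := hp (t - q) (by omega) (by omega)
    rw [show t - q + q = t by omega] at h₁
    rw [show t - q + p = t + (p - q) by omega] at h₂
    exact h₁.symm.trans h₂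
  · have h₁ := hp t ht (by omega)
    have h₂ := hq (t + (p - q)) (by omega) (by omega)
    rw [show t + (p - q) + q = t + p by omega] at h₂
    exact h₁.trans h₂.symm

/-- A weak form of the Fine–Wilf periodicity lemma: the least period divides every period `p`
with `p + q ≤ m`. -/
theorem HasWordPeriod.dvd_of_least {α : Type*} {w : ℕ → α} {m q : ℕ}
    (hq : HasWordPeriod w m q) (hmin : ∀ r, 0 < r → r ≤ m → HasWordPeriod w m r → q ≤ r)
    (hq0 : 0 < q) (p : ℕ) (hp : HasWordPeriod w m p) (hm : p + q ≤ m) : q ∣ p := by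
  induction p using Nat.strong_induction_on with
  | _ p ih =>
    rcases Nat.eq_zero_or_pos p with rfl | hp0
    · exact dvd_zero q
    · have hqp := hmin p hp0 (by omega) hp
      have hdvd := ih (p - q) (by omega) (hp.sub hq hqp hm) (by omega)
      rw [← Nat.sub_add_cancel hqp]
      exact dvd_add hdvd dvd_rfl

theorem HasWordPeriod.eq_add_mul {α : Type*} {w : ℕ → α} {m q : ℕ} (hq : HasWordPeriod w m q)
    {t : ℕ} (ht : 1 ≤ t) (k : ℕ) (hk : t + q * k ≤ m) : w t = w (t + q * k) := by
  induction k with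
  | zero => rfl
  | succ k ih =>
    rw [Nat.mul_succ, ← Nat.add_assoc] at hk ⊢
    exact (ih (by omega)).trans (hq _ (by omega) hk)

/-- For a word of length `n ≥ 1`, if `2·π^{(2)}[n] ≥ n - 2` then
`w[π[n]+1] = w[π^{(2)}[n]+1]`. -/
theorem second_iterate_large_implies_equal_letters {α : Type*} (w : ℕ → α) (n : ℕ)
    (hn : 1 ≤ n) (h : (n : ℤ) - 2 ≤ 2 * ((piF w)^[2] n : ℤ)) :
    w (piF w n + 1) = w ((piF w)^[2] n + 1) := by
  change (n : ℤ) - 2 ≤ 2 * (piF w (piF w n) : ℤ) at h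
  change w (piF w n + 1) = w (piF w (piF w n) + 1)
  obtain ⟨han, hba⟩ := piF_mem w hn
  rcases Nat.eq_zero_or_pos (piF w n) with ha0 | ha0
  · rw [ha0, piF_zero]
  obtain ⟨hlt, hbb⟩ := piF_mem w ha0
  have hmax : ∀ c, c < piF w n → IsBorder w (piF w n) c → c ≤ piF w (piF w n) :=
    fun c => le_piF w
  generalize piF w (piF w n) = b at *
  generalize piF w n = a at *
  rw [isBorder_iff_hasWordPeriod w han.le] at hba
  rw [isBorder_iff_hasWordPeriod w hlt.le] at hbb
  have hpa : HasWordPeriod w a (n - a) := fun t ht hta => hba t ht (by omega)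
  have hmin : ∀ r, 0 < r → r ≤ a → HasWordPeriod w a r → a - b ≤ r := by
    intro r hr hra hw
    have := hmax (a - r) (by omega)
      ((isBorder_iff_hasWordPeriod w (by omega)).mpr (by rwa [Nat.sub_sub_self hra]))
    omega
  have hdvd : a - b ∣ n - a := by
    by_cases hq1 : a - b = 1
    · rw [hq1]
      exact one_dvd _
    · exact hbb.dvd_of_least hmin (by omega) _ hpa (by omega)
  obtain ⟨k, hk⟩ := hdvd
  have hk0 : k ≠ 0 := by
    rintro rfl
    omega
  obtain ⟨j, rfl⟩ := Nat.exists_eq_succ_of_ne_zero hk0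
  rw [Nat.mul_succ] at hk
  have h₁ := hba (a + 1 - (n - a)) (by omega) (by omega)
  have h₂ := hbb.eq_add_mul (t := a + 1 - (n - a)) (by omega) j (by omega)
  rw [show a + 1 - (n - a) + (n - a) = a + 1 by omega] at h₁
  rw [show a + 1 - (n - a) + (a - b) * j = b + 1 by omega] at h₂
  exact h₁.symm.trans h₂
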